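/- Consider the structure (ℝ, <, +, ·, 2^ℤ), which is d-minimal. There exists a definable C² Morse function f : ℝ → ℝ such that for every positive definable continuous function ε : ℝ → ℝ there exists a definable C² function g : ℝ → ℝ with |g^{(j)}(x) − f^{(j)}(x)| < ε(x) for all x ∈ ℝ and j = 0, 1, 2, such that g is not a Morse function (g has two distinct critical points with the same critical value). Consequently, the set of definable C² Morse functions on ℝ is not open in D²(ℝ) with the D² topology. -/

import Mathlib

open FirstOrder Set Filter Topology
open scoped Classical

noncomputable section

namespace DMinPaper

variable (L : FirstOrder.Language) [L.Structure ℝ]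

/-- A subset of `ℝ^α` is definable (with parameters from `ℝ`) in the structure `L`. -/
def IsDef {α : Type} (s : Set (α → ℝ)) : Prop :=
  (Set.univ : Set ℝ).Definable L s

/-- Definability of an `ℝ`-valued function on a subset `M ⊆ ℝ^α`, via its graph. -/
def IsDefFunOn {α : Type} (M : Set (α → ℝ)) (f : (α → ℝ) → ℝ) : Prop :=
  IsDef L {z : (α ⊕ Unit) → ℝ |
    (fun i => z (Sum.inl i)) ∈ M ∧ z (Sum.inr ()) = f (fun i => z (Sum.inl i))}

/-- Definability of a map `M → ℝ^β` on a subset `M ⊆ ℝ^α`, via its graph. -/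
def IsDefMapOn {α β : Type} (M : Set (α → ℝ)) (f : (α → ℝ) → (β → ℝ)) : Prop :=
  IsDef L {z : (α ⊕ β) → ℝ |
    (fun i => z (Sum.inl i)) ∈ M ∧ (fun j => z (Sum.inr j)) = f (fun i => z (Sum.inl i))}

/-- Definability of an `ℝ`-valued function on a subset of a product `ℝ^α × ℝ^β`. -/
def IsDefFun2On {α β : Type} (S : Set ((α → ℝ) × (β → ℝ)))
    (f : (α → ℝ) × (β → ℝ) → ℝ) : Prop :=
  IsDef L {z : ((α ⊕ β) ⊕ Unit) → ℝ |
    ((fun i => z (Sum.inl (Sum.inl i)), fun j => z (Sum.inl (Sum.inr j))) ∈ S) ∧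
    z (Sum.inr ()) = f (fun i => z (Sum.inl (Sum.inl i)), fun j => z (Sum.inl (Sum.inr j)))}

/-- Definability of a map into `ℝ^γ` on a subset of a product `ℝ^α × ℝ^β`. -/
def IsDefMap2On {α β γ : Type} (S : Set ((α → ℝ) × (β → ℝ)))
    (f : (α → ℝ) × (β → ℝ) → (γ → ℝ)) : Prop :=
  IsDef L {z : ((α ⊕ β) ⊕ γ) → ℝ |
    ((fun i => z (Sum.inl (Sum.inl i)), fun j => z (Sum.inl (Sum.inr j))) ∈ S) ∧
    (fun l => z (Sum.inr l)) = f (fun i => z (Sum.inl (Sum.inl i)), fun j => z (Sum.inl (Sum.inr j)))}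

/-- Definability of a function `ℝ → ℝ`, via its graph. -/
def IsDefFunR (f : ℝ → ℝ) : Prop :=
  IsDef L {z : Fin 2 → ℝ | z 1 = f (z 0)}

/-- The structure expands the ordered field of real numbers: the order, addition and
multiplication are definable. -/
def ExpandsOrderedField : Prop :=
  IsDef L {x : Fin 2 → ℝ | x 0 < x 1} ∧
  IsDef L {x : Fin 3 → ℝ | x 2 = x 0 + x 1} ∧
  IsDef L {x : Fin 3 → ℝ | x 2 = x 0 * x 1}

/-- A discrete subset of `ℝ`. -/
def IsDiscreteSet (D : Set ℝ) : Prop :=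
  ∀ x ∈ D, ∃ U : Set ℝ, IsOpen U ∧ U ∩ D = {x}

/-- d-minimality: the structure expands the ordered field of reals, and in every definable
family of subsets of `ℝ` each fiber is the union of an open set and `N` discrete sets, where
`N` does not depend on the parameter. -/
def DMinimal : Prop :=
  ExpandsOrderedField L ∧
  ∀ (k : ℕ) (S : Set ((Fin k ⊕ Unit) → ℝ)), IsDef L S →
    ∃ N : ℕ, ∀ a : Fin k → ℝ,
      ∃ (U : Set ℝ) (D : Fin N → Set ℝ),
        IsOpen U ∧ (∀ i, IsDiscreteSet (D i)) ∧
        {t : ℝ | Sum.elim a (fun _ => t) ∈ S} = U ∪ ⋃ i, D i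

variable {E F : Type} [NormedAddCommGroup E] [NormedSpace ℝ E]
  [NormedAddCommGroup F] [NormedSpace ℝ F]

/-- `f` is of class `C^p` on `M` (as a function on the submanifold `M`): near each point of `M`
it coincides on `M` with a `C^p` function defined on an ambient open set. -/
def CpOn (p : ℕ) (f : E → F) (M : Set E) : Prop :=
  ∀ x ∈ M, ∃ (U : Set E) (g : E → F),
    IsOpen U ∧ x ∈ U ∧ ContDiffOn ℝ p g U ∧ Set.EqOn f g (M ∩ U)

/-- The tangent vectors to `M` at `x`: velocities of differentiable curves through `x`
staying in `M`. -/
def TangentVecs (M : Set E) (x : E) : Set E :=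
  {v | ∃ γ : ℝ → E, γ 0 = x ∧ (∀ᶠ t in 𝓝 (0:ℝ), γ t ∈ M) ∧ HasDerivAt γ v 0}

/-- The differential of `f : M → N` at `x` is surjective onto the tangent space of `N`
at `f x`. -/
def SubmersionAtOn (f : E → F) (M : Set E) (N : Set F) (x : E) : Prop :=
  ∀ w ∈ TangentVecs N (f x), ∃ (γ : ℝ → E) (v : E),
    γ 0 = x ∧ (∀ᶠ t in 𝓝 (0:ℝ), γ t ∈ M) ∧ HasDerivAt γ v 0 ∧
    HasDerivAt (fun t => f (γ t)) w 0

/-- `x` is a critical point of `f : M → ℝ`: the differential of `f` at `x` vanishes on all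
tangent vectors of `M` at `x`. -/
def IsCritPtOn (f : E → ℝ) (M : Set E) (x : E) : Prop :=
  x ∈ M ∧ ∀ (γ : ℝ → E) (v : E), γ 0 = x → (∀ᶠ t in 𝓝 (0:ℝ), γ t ∈ M) →
    HasDerivAt γ v 0 → HasDerivAt (fun t => f (γ t)) 0 0

/-- `x` is a nondegenerate critical point of `f : M → ℝ` on the `d`-dimensional submanifold
`M`: in a local `C²` parametrization `ψ` of `M` at `x`, the Hessian of `f ∘ ψ` is a
nondegenerate bilinear form. -/
def IsNondegCritPtOn (f : E → ℝ) (M : Set E) (d : ℕ) (x : E) : Prop :=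
  IsCritPtOn f M x ∧
  ∃ (W : Set (Fin d → ℝ)) (ψ : (Fin d → ℝ) → E) (w0 : Fin d → ℝ),
    IsOpen W ∧ w0 ∈ W ∧ ContDiffOn ℝ 2 ψ W ∧ ψ w0 = x ∧ Set.MapsTo ψ W M ∧
    Function.Injective (fun u => fderiv ℝ ψ w0 u) ∧
    ∀ v : Fin d → ℝ, v ≠ 0 → ∃ w : Fin d → ℝ,
      iteratedFDeriv ℝ 2 (fun z => f (ψ z)) w0 ![v, w] ≠ 0

/-- `f` is a Morse function on the `d`-dimensional submanifold `M`: all critical points are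
nondegenerate and distinct critical points have distinct critical values. -/
def IsMorseOn (f : E → ℝ) (M : Set E) (d : ℕ) : Prop :=
  (∀ x, IsCritPtOn f M x → IsNondegCritPtOn f M d x) ∧
  ∀ x y, IsCritPtOn f M x → IsCritPtOn f M y → x ≠ y → f x ≠ f y

/-- `M ⊆ ℝⁿ` is a definable `C^p` submanifold of dimension `d`: `M` is definable and every
point of `M` has a definable `C^p` chart of `ℝⁿ` flattening `M` onto `ℝ^d × {0}`. -/
def IsDpSubmanifold (p : ℕ) {n : ℕ} (d : ℕ) (M : Set (Fin n → ℝ)) : Prop :=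
  IsDef L M ∧ d ≤ n ∧
  ∀ x ∈ M, ∃ (U V : Set (Fin n → ℝ)) (φ ψ : (Fin n → ℝ) → (Fin n → ℝ)),
    IsOpen U ∧ x ∈ U ∧ IsOpen V ∧ (0 : Fin n → ℝ) ∈ V ∧
    IsDef L U ∧ IsDef L V ∧ IsDefMapOn L U φ ∧ IsDefMapOn L V ψ ∧
    ContDiffOn ℝ p φ U ∧ ContDiffOn ℝ p ψ V ∧
    Set.MapsTo φ U V ∧ Set.MapsTo ψ V U ∧
    (∀ y ∈ U, ψ (φ y) = y) ∧ (∀ y ∈ V, φ (ψ y) = y) ∧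
    φ x = 0 ∧ φ '' (M ∩ U) = V ∩ {y | ∀ i : Fin n, d ≤ (i : ℕ) → y i = 0}

/-- The definable set `X ⊆ ℝⁿ` has dimension at least `d`: some projection of `X` onto `d`
of the coordinates has nonempty interior. -/
def hasDimGE {n : ℕ} (X : Set (Fin n → ℝ)) (d : ℕ) : Prop :=
  ∃ ι : Fin d → Fin n, StrictMono ι ∧ (interior ((fun x => fun i => x (ι i)) '' X)).Nonempty

/-- The dimension of `X ⊆ ℝⁿ`: the largest `d` such that some coordinate projection of `X`
onto `ℝ^d` has nonempty interior; `⊥` (i.e. `-∞`) for the empty set. -/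
noncomputable def dimDef {n : ℕ} (X : Set (Fin n → ℝ)) : WithBot ℕ :=
  if X.Nonempty then ((sSup {d : ℕ | hasDimGE X d} : ℕ) : WithBot ℕ) else ⊥

/-- The coordinate projection `ℝⁿ → ℝ^d` determined by `ι`. -/
def projc {n d : ℕ} (ι : Fin d → Fin n) (x : Fin n → ℝ) : Fin d → ℝ := fun i => x (ι i)

/-- An open box in `ℝⁿ`: a product of `n` nonempty open intervals. -/
def IsOpenBox {n : ℕ} (U : Set (Fin n → ℝ)) : Prop :=
  ∃ a b : Fin n → ℝ, (∀ i, a i < b i) ∧ U = Set.univ.pi fun i => Set.Ioo (a i) (b i)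

/-- `M` is locally, at `x`, the image of a definable `C^p` section `τ` of the coordinate
projection `projc ι`. -/
def MultiGraphPtAt (p : ℕ) {n d : ℕ} (ι : Fin d → Fin n) (M : Set (Fin n → ℝ))
    (x : Fin n → ℝ) : Prop :=
  ∃ U : Set (Fin n → ℝ), IsOpenBox U ∧ x ∈ U ∧
    ∃ τ : (Fin d → ℝ) → (Fin n → ℝ),
      IsDefMapOn L (projc ι '' U) τ ∧ ContDiffOn ℝ p τ (projc ι '' U) ∧
      M ∩ U = τ '' (projc ι '' U) ∧ ∀ z ∈ projc ι '' U, projc ι (τ z) = z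

/-- A `D^p` multi-valued graph with respect to the coordinate projection `projc ι`. -/
def IsMultiGraph (p : ℕ) {n d : ℕ} (ι : Fin d → Fin n) (M : Set (Fin n → ℝ)) : Prop :=
  IsDpSubmanifold L p d M ∧ ∀ x ∈ M, MultiGraphPtAt L p ι M x

/-- The gradient vector `(∂g/∂x₁, …, ∂g/∂x_d)` of `g : ℝ^d → ℝ` at `z`. -/
noncomputable def gradVec {d : ℕ} (g : (Fin d → ℝ) → ℝ) (z : Fin d → ℝ) : Fin d → ℝ :=
  fun i => fderiv ℝ g z (Pi.single i 1)

/-- The Hessian matrix `(∂²g/∂x_i∂x_j)` of `g : ℝ^d → ℝ` at `z`. -/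
noncomputable def hessMat {d : ℕ} (g : (Fin d → ℝ) → ℝ) (z : Fin d → ℝ) :
    Matrix (Fin d) (Fin d) ℝ :=
  Matrix.of fun i j => fderiv ℝ (fun w => fderiv ℝ g w (Pi.single j 1)) z (Pi.single i 1)

/-- The derivative of `f : M → ℝ` at `x` along the vector field `D`: the common value of
`d_x g (D x)` over all local `C¹` extensions `g` of `f` (and `0` if there is no such common
value). -/
noncomputable def vderiv (M : Set E) (D : E → E) (f : E → ℝ) (x : E) : ℝ :=
  if h : ∃ w : ℝ, ∀ (U : Set E) (g : E → ℝ), IsOpen U → x ∈ U → ContDiffOn ℝ 1 g U →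
      Set.EqOn f g (M ∩ U) → fderiv ℝ g x (D x) = w
  then h.choose else 0

/-- Iterated derivative `D_{α₁} ⋯ D_{α_m} f` of `f : M → ℝ` along a finite family of vector
fields, indexed by a list `α`. -/
noncomputable def vderivIter {k : ℕ} (M : Set E) (D : Fin k → E → E) :
    List (Fin k) → (E → ℝ) → E → ℝ
  | [], f => f
  | i :: l, f => vderiv M (D i) (vderivIter M D l f)

/-- A Morse function `ℝ → ℝ`. -/
def IsMorseR (f : ℝ → ℝ) : Prop :=
  (∀ x, deriv f x = 0 → deriv (deriv f) x ≠ 0) ∧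
  ∀ x y, deriv f x = 0 → deriv f y = 0 → x ≠ y → f x ≠ f y

section Mine

/-- definable predicate -/
def DS {α : Type} (p : (α → ℝ) → Prop) : Prop := IsDef L {z | p z}

/-- definable function -/
def DFn {α : Type} (f : (α → ℝ) → ℝ) : Prop :=
  IsDef L {w : (α ⊕ Unit) → ℝ | w (Sum.inr ()) = f (fun i => w (Sum.inl i))}

variable {L}

theorem DS.and {α : Type} {p q : (α → ℝ) → Prop} (hp : DS L p) (hq : DS L q) :
    DS L (fun z => p z ∧ q z) := Set.Definable.inter hp hq

theorem DS.or {α : Type} {p q : (α → ℝ) → Prop} (hp : DS L p) (hq : DS L q) :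
    DS L (fun z => p z ∨ q z) := Set.Definable.union hp hq

theorem DS.not {α : Type} {p : (α → ℝ) → Prop} (hp : DS L p) :
    DS L (fun z => ¬ p z) := Set.Definable.compl hp

theorem DS.ex {α : Type} [Finite α] {p : (α → ℝ) → ℝ → Prop}
    (h : DS L (fun w : (α ⊕ Unit) → ℝ => p (fun i => w (Sum.inl i)) (w (Sum.inr ())))) :
    DS L (fun z => ∃ t, p z t) := by
  have := Set.Definable.image_comp_sumInl_fin (M := ℝ) (L := L) (A := Set.univ) (α := α) 1
    (s := {w | p (fun i => w (Sum.inl i)) (w (Sum.inr 0))})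
    (by
      have h2 := Set.Definable.preimage_comp (Sum.map id (fun _ : Unit => (0 : Fin 1))) h
      exact h2)
  have e : {z : α → ℝ | ∃ t, p z t} = ((fun g : (α ⊕ Fin 1) → ℝ => g ∘ Sum.inl) ''
      {w | p (fun i => w (Sum.inl i)) (w (Sum.inr 0))}) := by
    ext z
    constructor
    · rintro ⟨t, ht⟩
      exact ⟨Sum.elim z (fun _ => t), ht, rfl⟩
    · rintro ⟨w, hw, rfl⟩
      exact ⟨_, hw⟩
  unfold DS IsDef
  rw [e]; exact this

theorem DS.subst {α : Type} [Finite α] {k : ℕ} {S : Set (Fin k → ℝ)} (hS : IsDef L S)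
    (f : Fin k → (α → ℝ) → ℝ) (hf : ∀ i, DFn L (f i)) :
    DS L (fun z => (fun i => f i z) ∈ S) := by
  have h1 : (Set.univ : Set ℝ).Definable L
      {w : (α ⊕ Fin k) → ℝ | (fun i => w (Sum.inr i)) ∈ S} :=
    Set.Definable.preimage_comp (fun i : Fin k => (Sum.inr i : α ⊕ Fin k)) hS
  have h2 : ∀ i : Fin k, (Set.univ : Set ℝ).Definable L
      {w : (α ⊕ Fin k) → ℝ | w (Sum.inr i) = f i (fun j => w (Sum.inl j))} := fun i =>
    Set.Definable.preimage_comp (Sum.map id (fun _ : Unit => i)) (hf i)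
  have h3 := Set.definable_biInter_finset (s := Finset.univ) h2
  have := Set.Definable.image_comp_sumInl_fin k (h1.inter h3)
  unfold DS IsDef
  convert this using 1
  ext z
  constructor
  · intro h
    refine ⟨Sum.elim z (fun i => f i z), ⟨h, ?_⟩, rfl⟩
    simp
  · rintro ⟨w, ⟨hw, hw2⟩, rfl⟩
    simp only [Finset.mem_univ, Set.iInter_true, Set.mem_iInter, Set.mem_ofPred_eq] at hw2 hw
    have : (fun i => f i (w ∘ Sum.inl)) = fun i => w (Sum.inr i) := by
      funext i; exact (hw2 i).symm
    simp only [Set.mem_ofPred_eq, this, hw]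

theorem DFn.coord {α : Type} (i : α) : DFn L (fun z : α → ℝ => z i) := by
  refine ⟨(FirstOrder.Language.var (Sum.inr ())).equal (FirstOrder.Language.var (Sum.inl i)), ?_⟩
  ext w
  simp

theorem DFn.const {α : Type} (c : ℝ) : DFn L (fun _ : α → ℝ => c) := by
  refine ⟨(FirstOrder.Language.var (Sum.inr ())).equal
    (FirstOrder.Language.Constants.term (L.con (⟨c, trivial⟩ : (Set.univ : Set ℝ)))), ?_⟩
  ext w
  simp

theorem DFn.lift {α : Type} {f : (α → ℝ) → ℝ} (hf : DFn L f) :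
    DFn L (fun w : (α ⊕ Unit) → ℝ => f (fun i => w (Sum.inl i))) :=
  Set.Definable.preimage_comp (Sum.map Sum.inl id) hf

theorem DFn.add (h : ExpandsOrderedField L) {α : Type} [Finite α] {f g : (α → ℝ) → ℝ}
    (hf : DFn L f) (hg : DFn L g) : DFn L (fun z => f z + g z) := by
  have := DS.subst h.2.1 ![fun w : (α ⊕ Unit) → ℝ => f (fun i => w (Sum.inl i)),
    fun w => g (fun i => w (Sum.inl i)), fun w => w (Sum.inr ())]
    (by intro i; fin_cases i; exacts [hf.lift, hg.lift, DFn.coord _])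
  exact this

theorem DFn.mul (h : ExpandsOrderedField L) {α : Type} [Finite α] {f g : (α → ℝ) → ℝ}
    (hf : DFn L f) (hg : DFn L g) : DFn L (fun z => f z * g z) := by
  have := DS.subst h.2.2 ![fun w : (α ⊕ Unit) → ℝ => f (fun i => w (Sum.inl i)),
    fun w => g (fun i => w (Sum.inl i)), fun w => w (Sum.inr ())]
    (by intro i; fin_cases i; exacts [hf.lift, hg.lift, DFn.coord _])
  exact this

theorem DS.lt (h : ExpandsOrderedField L) {α : Type} [Finite α] {f g : (α → ℝ) → ℝ}
    (hf : DFn L f) (hg : DFn L g) : DS L (fun z => f z < g z) :=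
  DS.subst h.1 ![f, g] (by intro i; fin_cases i; exacts [hf, hg])

theorem DS.le (h : ExpandsOrderedField L) {α : Type} [Finite α] {f g : (α → ℝ) → ℝ}
    (hf : DFn L f) (hg : DFn L g) : DS L (fun z => f z ≤ g z) := by
  have := (DS.lt h hg hf).not
  simpa only [not_lt] using this

theorem DS.eq (h : ExpandsOrderedField L) {α : Type} [Finite α] {f g : (α → ℝ) → ℝ}
    (hf : DFn L f) (hg : DFn L g) : DS L (fun z => f z = g z) := by
  have := (DS.le h hg hf).and (DS.le h hf hg)
  simpa only [← le_antisymm_iff, eq_comm] using this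

theorem DS.pow (h : IsDef L {x : Fin 1 → ℝ | ∃ m : ℤ, x 0 = 2 ^ m})
    {α : Type} [Finite α] {f : (α → ℝ) → ℝ} (hf : DFn L f) :
    DS L (fun z => ∃ m : ℤ, f z = 2 ^ m) :=
  DS.subst h ![f] (by intro i; fin_cases i; exacts [hf])

/-- composition with a one-variable definable function -/
theorem DFn.comp {α : Type} [Finite α] {F : ℝ → ℝ} (hF : IsDefFunR L F) {f : (α → ℝ) → ℝ}
    (hf : DFn L f) : DFn L (fun z => F (f z)) :=
  DS.subst hF ![fun w : (α ⊕ Unit) → ℝ => f (fun i => w (Sum.inl i)), fun w => w (Sum.inr ())]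
    (by intro i; fin_cases i; exacts [hf.lift, DFn.coord _])

theorem isDefFunR_add (h : ExpandsOrderedField L) {F G : ℝ → ℝ} (hF : IsDefFunR L F)
    (hG : IsDefFunR L G) : IsDefFunR L (fun x => F x + G x) :=
  DS.eq h (DFn.coord 1) (DFn.add h (DFn.comp hF (DFn.coord 0)) (DFn.comp hG (DFn.coord 0)))

/-! ### the bump function -/

/-- cube of positive part -/
def mx (y : ℝ) : ℝ := max 0 y

theorem mx_nonneg {y : ℝ} (h : 0 ≤ y) : mx y = y := max_eq_right h
theorem mx_nonpos {y : ℝ} (h : y ≤ 0) : mx y = 0 := max_eq_left h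

theorem mx_cont : Continuous mx := by unfold mx; fun_prop

theorem mx_deriv (n : ℕ) (y : ℝ) :
    HasDerivAt (fun y => mx y ^ (n + 2)) ((n + 2 : ℝ) * mx y ^ (n + 1)) y := by
  have key : ∀ y : ℝ, HasDerivAt (fun y : ℝ => y ^ (n + 2)) ((n + 2 : ℝ) * y ^ (n + 1)) y := by
    intro y
    have := hasDerivAt_pow (n + 2) y
    simpa using this
  have h1 : 0 ≤ y → HasDerivWithinAt (fun y => mx y ^ (n + 2))
      ((n + 2 : ℝ) * mx y ^ (n + 1)) (Ici 0) y := by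
    intro h
    rw [mx_nonneg h]
    exact (key y).hasDerivWithinAt.congr (fun x hx => by rw [mx_nonneg hx]) (by rw [mx_nonneg h])
  have h2 : y ≤ 0 → HasDerivWithinAt (fun y => mx y ^ (n + 2))
      ((n + 2 : ℝ) * mx y ^ (n + 1)) (Iic 0) y := by
    intro h
    rw [mx_nonpos h]
    have := (hasDerivWithinAt_const y (Iic 0) (0 : ℝ))
    simp only [ne_eq, Nat.add_eq_zero_iff, one_ne_zero, and_false, not_false_eq_true, zero_pow,
      mul_zero]
    exact this.congr (fun x hx => by rw [mx_nonpos hx]; simp) (by rw [mx_nonpos h]; simp)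
  rcases lt_trichotomy y 0 with h | h | h
  · exact (h2 h.le).hasDerivAt (Iic_mem_nhds h)
  · have := (h2 h.le).union (h1 h.ge)
    rw [Iic_union_Ici] at this
    simpa using this
  · exact (h1 h.le).hasDerivAt (Ici_mem_nhds h)

theorem contDiff_two {f f1 f2 : ℝ → ℝ} (h1 : ∀ x, HasDerivAt f (f1 x) x)
    (h2 : ∀ x, HasDerivAt f1 (f2 x) x) (h3 : Continuous f2) : ContDiff ℝ 2 f := by
  have e1 : deriv f = f1 := funext fun x => (h1 x).deriv
  have e2 : deriv f1 = f2 := funext fun x => (h2 x).deriv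
  have a : ContDiff ℝ 1 f1 := by
    rw [contDiff_one_iff_deriv]
    exact ⟨fun x => (h2 x).differentiableAt, by rw [e2]; exact h3⟩
  have : ContDiff ℝ (1 + 1) f := by
    rw [contDiff_succ_iff_deriv]
    refine ⟨fun x => (h1 x).differentiableAt, by simp, by rw [e1]; exact a⟩
  simpa [one_add_one_eq_two] using this

/-- bump at `p` -/
def bump (p x : ℝ) : ℝ := mx (1 - (x - p) ^ 2) ^ 3
/-- its derivative -/
def bump1 (p x : ℝ) : ℝ := 3 * mx (1 - (x - p) ^ 2) ^ 2 * (-(2 * (x - p)))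
/-- its second derivative -/
def bump2 (p x : ℝ) : ℝ := 3 * (2 * mx (1 - (x - p) ^ 2) ^ 1 * (-(2 * (x - p)))) * (-(2 * (x - p)))
   + 3 * mx (1 - (x - p) ^ 2) ^ 2 * (-2)

theorem inner_deriv (p x : ℝ) : HasDerivAt (fun x : ℝ => 1 - (x - p) ^ 2) (-(2 * (x - p))) x := by
  have := (((hasDerivAt_id x).sub_const p).pow 2).const_sub 1
  simpa using this

theorem bump_deriv (p x : ℝ) : HasDerivAt (bump p) (bump1 p x) x := by
  have := (mx_deriv 1 (1 - (x - p) ^ 2)).comp x (inner_deriv p x)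
  unfold bump1
  norm_num at this
  exact this.congr_deriv (by ring)

theorem bump1_deriv (p x : ℝ) : HasDerivAt (bump1 p) (bump2 p x) x := by
  have a := (mx_deriv 0 (1 - (x - p) ^ 2)).comp x (inner_deriv p x)
  have b : HasDerivAt (fun x : ℝ => (-(2 * (x - p)))) (-2) x := by
    have := (((hasDerivAt_id x).sub_const p).const_mul 2).neg
    exact this.congr_deriv (by ring)
  have := (a.const_mul 3).mul b
  unfold bump2
  norm_num at this ⊢
  exact this

theorem bump_contDiff (p : ℝ) : ContDiff ℝ 2 (bump p) := by
  refine contDiff_two (bump_deriv p) (bump1_deriv p) ?_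
  unfold bump2
  have := mx_cont
  fun_prop

theorem bump_supp (p : ℝ) : HasCompactSupport (bump p) := by
  refine HasCompactSupport.intro (isCompact_Icc (a := p - 1) (b := p + 1)) ?_
  intro x hx
  have : 1 - (x - p) ^ 2 ≤ 0 := by
    by_contra hc
    apply hx
    constructor <;> nlinarith
  simp [bump, mx_nonpos this]

theorem bump_def (h : ExpandsOrderedField L) (p : ℝ) : IsDefFunR L (bump p) := by
  have hm : IsDefFunR L (fun y => mx y) := by
    have : DS L (fun z : Fin 2 → ℝ => (0 ≤ z 0 ∧ z 1 = z 0) ∨ (z 0 < 0 ∧ z 1 = 0)) :=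
      ((DS.le h (DFn.const 0) (DFn.coord 0)).and (DS.eq h (DFn.coord 1) (DFn.coord 0))).or
       ((DS.lt h (DFn.coord 0) (DFn.const 0)).and (DS.eq h (DFn.coord 1) (DFn.const 0)))
    convert this using 1
    unfold IsDefFunR DS
    congr! 3 with z
    rcases le_or_gt 0 (z 0) with h | h
    · simp [mx_nonneg h, h, not_lt.2 h]
    · simp [mx_nonpos h.le, h, not_le.2 h]
  have e1 : DFn L (fun z : Fin 2 → ℝ => z 0 + (-p)) := DFn.add h (DFn.coord 0) (DFn.const _)
  have e2 := DFn.comp hm (DFn.add h (DFn.const 1) (DFn.mul h (DFn.const (-1)) (DFn.mul h e1 e1)))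
  have := DS.eq h (DFn.coord 1) (DFn.mul h e2 (DFn.mul h e2 e2))
  convert this using 1
  unfold IsDefFunR DS bump
  congr! 3 with z
  have : 1 - (z 0 - p) ^ 2 = 1 + -1 * ((z 0 + -p) * (z 0 + -p)) := by ring
  rw [this]; ring

theorem supp_iter {B : ℝ → ℝ} (hs : HasCompactSupport B) (j : ℕ) :
    HasCompactSupport (iteratedDeriv j B) := by
  induction j with
  | zero => simpa using hs
  | succ n ih => rw [iteratedDeriv_succ]; exact ih.deriv

theorem small_exists {B ε : ℝ → ℝ} (hB : ContDiff ℝ 2 B) (hs : HasCompactSupport B)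
    (hε : Continuous ε) (hpos : ∀ x, 0 < ε x) :
    ∃ δ > 0, ∀ c : ℝ, |c| < δ → ∀ j ≤ 2, ∀ x, |c * iteratedDeriv j B x| < ε x := by
  have key : ∀ j ≤ 2, ∃ C : ℝ, ∀ x, |iteratedDeriv j B x| ≤ C * ε x := by
    intro j hj
    have hc : Continuous (iteratedDeriv j B) := hB.continuous_iteratedDeriv j (by exact_mod_cast hj)
    have hc2 : Continuous (fun x => (ε x)⁻¹ * iteratedDeriv j B x) :=
      (hε.inv₀ (fun x => (hpos x).ne')).mul hc
    obtain ⟨C, hC⟩ := hc2.bounded_above_of_compact_support (supp_iter hs j).mul_left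
    refine ⟨C, fun x => ?_⟩
    have := hC x
    rw [Real.norm_eq_abs, abs_mul, abs_of_pos (inv_pos.2 (hpos x)), inv_mul_le_iff₀ (hpos x)] at this
    linarith
  obtain ⟨C0, h0⟩ := key 0 (by norm_num)
  obtain ⟨C1, h1⟩ := key 1 (by norm_num)
  obtain ⟨C2, h2⟩ := key 2 (by norm_num)
  refine ⟨1 / (|C0| + |C1| + |C2| + 1), by positivity, ?_⟩
  intro c hc j hj x
  rw [lt_div_iff₀ (by positivity)] at hc
  have hb : |iteratedDeriv j B x| ≤ (|C0| + |C1| + |C2| + 1) * ε x := by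
    have := hpos x
    have := le_abs_self C0
    have := le_abs_self C1
    have := le_abs_self C2
    have := abs_nonneg C0
    have := abs_nonneg C1
    have := abs_nonneg C2
    interval_cases j
    · refine (h0 x).trans ?_; gcongr; linarith
    · refine (h1 x).trans ?_; gcongr; linarith
    · refine (h2 x).trans ?_; gcongr; linarith
  rw [abs_mul]
  calc |c| * |iteratedDeriv j B x| ≤ |c| * ((|C0| + |C1| + |C2| + 1) * ε x) := by gcongr
    _ = (|c| * (|C0| + |C1| + |C2| + 1)) * ε x := by ring
    _ < 1 * ε x := by gcongr; exact hpos x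
    _ = ε x := one_mul _

/-! ### the main function on the positive half line -/

/-- pieces -/
def Q (m : ℤ) (u : ℝ) : ℝ := if m < 0 then
    (-1) ^ m * (10 * u ^ 3 * (2 ^ m)⁻¹ - 45 * u ^ 2 + 60 * u * 2 ^ m - 24 * (2 ^ m) ^ 2)
  else (1 - 15 / 2 * (u - 1) ^ 2) ^ 2
/-- first derivative of pieces -/
def Q1 (m : ℤ) (u : ℝ) : ℝ := if m < 0 then
    (-1) ^ m * (30 * u ^ 2 * (2 ^ m)⁻¹ - 90 * u + 60 * 2 ^ m)
  else 225 * (u - 1) ^ 3 - 30 * (u - 1)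
/-- second derivative of pieces -/
def Q2 (m : ℤ) (u : ℝ) : ℝ := if m < 0 then
    (-1) ^ m * (60 * u * (2 ^ m)⁻¹ - 90)
  else 675 * (u - 1) ^ 2 - 30

theorem Q_deriv (m : ℤ) (u : ℝ) : HasDerivAt (Q m) (Q1 m u) u := by
  unfold Q Q1
  have hi := hasDerivAt_id u
  split_ifs with h
  · have := (((((hi.pow 3).const_mul 10).mul_const ((2 : ℝ) ^ m)⁻¹).sub
      ((hi.pow 2).const_mul 45)).add ((hi.const_mul 60).mul_const ((2 : ℝ) ^ m))).sub_const
      (24 * ((2 : ℝ) ^ m) ^ 2)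
    refine (this.const_mul ((-1 : ℝ) ^ m)).congr_deriv ?_
    simp; left; ring
  · have := (((((hi.sub_const 1).pow 2).const_mul (15 / 2)).const_sub 1).pow 2)
    refine this.congr_deriv ?_
    simp; ring

theorem Q1_deriv (m : ℤ) (u : ℝ) : HasDerivAt (Q1 m) (Q2 m u) u := by
  unfold Q1 Q2
  have hi := hasDerivAt_id u
  split_ifs with h
  · have := (((((hi.pow 2).const_mul 30).mul_const ((2 : ℝ) ^ m)⁻¹).sub
      (hi.const_mul 90)).add_const (60 * (2 : ℝ) ^ m))
    refine (this.const_mul ((-1 : ℝ) ^ m)).congr_deriv ?_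
    simp; ring_nf; simp
  · have := ((((hi.sub_const 1).pow 3).const_mul 225).sub ((hi.sub_const 1).const_mul 30))
    refine this.congr_deriv ?_
    simp; ring

theorem Q2_cont (m : ℤ) : Continuous (Q2 m) := by
  unfold Q2
  split_ifs <;> fun_prop

theorem neg_one_pred (m : ℤ) : (-1 : ℝ) ^ (m - 1) = - (-1) ^ m := by
  rw [zpow_sub_one₀ (by norm_num)]; norm_num

theorem Q_match (m : ℤ) : Q (m - 1) (2 ^ m) = Q m (2 ^ m) := by
  have hp : (2 : ℝ) ^ m ≠ 0 := by positivity
  unfold Q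
  rcases lt_trichotomy m 0 with h | h | h
  · rw [if_pos h, if_pos (by omega), neg_one_pred, zpow_sub_one₀ (by norm_num)]
    field_simp; ring
  · subst h; norm_num
  · rw [if_neg (by omega), if_neg (by omega)]

theorem Q1_match (m : ℤ) : Q1 (m - 1) (2 ^ m) = Q1 m (2 ^ m) := by
  have hp : (2 : ℝ) ^ m ≠ 0 := by positivity
  unfold Q1
  rcases lt_trichotomy m 0 with h | h | h
  · rw [if_pos h, if_pos (by omega), neg_one_pred, zpow_sub_one₀ (by norm_num)]
    field_simp; ring
  · subst h; norm_num
  · rw [if_neg (by omega), if_neg (by omega)]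

theorem Q2_match (m : ℤ) : Q2 (m - 1) (2 ^ m) = Q2 m (2 ^ m) := by
  have hp : (2 : ℝ) ^ m ≠ 0 := by positivity
  unfold Q2
  rcases lt_trichotomy m 0 with h | h | h
  · rw [if_pos h, if_pos (by omega), neg_one_pred, zpow_sub_one₀ (by norm_num)]
    field_simp; ring
  · subst h; norm_num
  · rw [if_neg (by omega), if_neg (by omega)]

/-- glued functions -/
def Gl (q : ℤ → ℝ → ℝ) (u : ℝ) : ℝ := q (Int.log 2 u) u

theorem log_unique {u : ℝ} {m : ℤ} (h1 : (2 : ℝ) ^ m ≤ u) (h2 : u < 2 ^ (m + 1)) :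
    Int.log 2 u = m := by
  have hu : 0 < u := lt_of_lt_of_le (by positivity) h1
  have a := (Int.zpow_le_iff_le_log (b := 2) (by norm_num) hu (x := m)).1 (by exact_mod_cast h1)
  have b := (Int.lt_zpow_iff_log_lt (b := 2) (by norm_num) hu (x := m + 1)).1 (by exact_mod_cast h2)
  omega

theorem log_spec {u : ℝ} (hu : 0 < u) : (2 : ℝ) ^ (Int.log 2 u) ≤ u ∧ u < 2 ^ (Int.log 2 u + 1) :=
  ⟨by exact_mod_cast Int.zpow_log_le_self (b := 2) (by norm_num) hu,
   by exact_mod_cast Int.lt_zpow_succ_log_self (b := 2) (by norm_num) u⟩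

theorem Gl_eq {q : ℤ → ℝ → ℝ} (hq : ∀ m, q (m - 1) (2 ^ m) = q m (2 ^ m)) (m : ℤ) {u : ℝ}
    (hu : u ∈ Icc ((2 : ℝ) ^ m) (2 ^ (m + 1))) : Gl q u = q m u := by
  unfold Gl
  rcases hu.2.lt_or_eq with h | h
  · rw [log_unique hu.1 h]
  · have : Int.log 2 u = m + 1 := by
      apply log_unique h.ge
      rw [h]; exact zpow_lt_zpow_right₀ (by norm_num) (by omega)
    rw [this, h]
    have := hq (m + 1)
    rw [add_sub_cancel_right] at this
    exact this.symm

theorem zpow_lt' (m : ℤ) : (2 : ℝ) ^ m < 2 ^ (m + 1) :=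
  zpow_lt_zpow_right₀ (by norm_num) (by omega)

theorem Gl_deriv {q q' : ℤ → ℝ → ℝ} (hq : ∀ m, q (m - 1) (2 ^ m) = q m (2 ^ m))
    (hq' : ∀ m, q' (m - 1) (2 ^ m) = q' m (2 ^ m))
    (hd : ∀ m u, HasDerivAt (q m) (q' m u) u) {u : ℝ} (hu : 0 < u) :
    HasDerivAt (Gl q) (Gl q' u) u := by
  have key : ∀ m : ℤ, u ∈ Icc ((2 : ℝ) ^ m) (2 ^ (m + 1)) →
      HasDerivWithinAt (Gl q) (Gl q' u) (Icc ((2 : ℝ) ^ m) (2 ^ (m + 1))) u := by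
    intro m hm
    rw [Gl_eq hq' m hm]
    exact (hd m u).hasDerivWithinAt.congr (fun x hx => Gl_eq hq m hx) (Gl_eq hq m hm)
  obtain ⟨h1, h2⟩ := log_spec hu
  generalize Int.log 2 u = m at h1 h2
  rcases h1.lt_or_eq with h | h
  · exact (key m ⟨h1, h2.le⟩).hasDerivAt (Icc_mem_nhds h h2)
  · have a := zpow_lt' (m - 1)
    have k1 := key (m - 1)
    rw [sub_add_cancel] at k1 a
    have := (k1 ⟨by rw [← h]; exact a.le, h.ge⟩).union (key m ⟨h1, h2.le⟩)
    rw [Icc_union_Icc_eq_Icc a.le (zpow_lt' m).le] at this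
    exact this.hasDerivAt (Icc_mem_nhds (h ▸ a) h2)

theorem Gl_cont {q : ℤ → ℝ → ℝ} (hq : ∀ m, q (m - 1) (2 ^ m) = q m (2 ^ m))
    (hd : ∀ m, Continuous (q m)) {u : ℝ} (hu : 0 < u) :
    ContinuousAt (Gl q) u := by
  have key : ∀ m : ℤ, u ∈ Icc ((2 : ℝ) ^ m) (2 ^ (m + 1)) →
      ContinuousWithinAt (Gl q) (Icc ((2 : ℝ) ^ m) (2 ^ (m + 1))) u := by
    intro m hm
    exact (hd m).continuousWithinAt.congr (fun x hx => Gl_eq hq m hx) (Gl_eq hq m hm)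
  obtain ⟨h1, h2⟩ := log_spec hu
  generalize Int.log 2 u = m at h1 h2
  rcases h1.lt_or_eq with h | h
  · exact (key m ⟨h1, h2.le⟩).continuousAt (Icc_mem_nhds h h2)
  · have a := zpow_lt' (m - 1)
    have k1 := key (m - 1)
    rw [sub_add_cancel] at k1 a
    have := (k1 ⟨by rw [← h]; exact a.le, h.ge⟩).union (key m ⟨h1, h2.le⟩)
    rw [Icc_union_Icc_eq_Icc a.le (zpow_lt' m).le] at this
    exact this.continuousAt (Icc_mem_nhds (h ▸ a) h2)

/-- the special critical point -/
def p0 : ℝ := 1 + √(2 / 15)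

theorem p0_sq : (p0 - 1) ^ 2 = 2 / 15 := by
  unfold p0
  rw [add_sub_cancel_left, Real.sq_sqrt (by norm_num)]

theorem p0_gt : 1 < p0 := by
  unfold p0
  have : 0 < √(2 / 15 : ℝ) := Real.sqrt_pos.2 (by norm_num)
  linarith

theorem log_neg_iff {u : ℝ} (hu : 0 < u) : Int.log 2 u < 0 ↔ u < 1 := by
  have := Int.lt_zpow_iff_log_lt (b := 2) (by norm_num) hu (x := 0)
  simpa using this.symm

theorem Gl_ge {u : ℝ} (hu : 1 ≤ u) : Gl Q u = (1 - 15 / 2 * (u - 1) ^ 2) ^ 2 ∧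
    Gl Q1 u = 225 * (u - 1) ^ 3 - 30 * (u - 1) ∧ Gl Q2 u = 675 * (u - 1) ^ 2 - 30 := by
  have : ¬ Int.log 2 u < 0 := by rw [log_neg_iff (by linarith)]; linarith
  simp [Gl, Q, Q1, Q2, this]

theorem Gl_p0 : Gl Q p0 = 0 ∧ Gl Q1 p0 = 0 ∧ Gl Q2 p0 = 60 := by
  obtain ⟨a, b, c⟩ := Gl_ge p0_gt.le
  have h := p0_sq
  refine ⟨by rw [a, h]; norm_num, ?_, by rw [c, h]; norm_num⟩
  rw [b, pow_succ, h]; ring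

theorem Gl_pow (m : ℤ) (hm : m ≤ 0) : Gl Q (2 ^ m) = (-4) ^ m ∧ Gl Q1 (2 ^ m) = 0 ∧
    Gl Q2 (2 ^ m) = -30 * (-1) ^ m := by
  have hl : Int.log 2 ((2 : ℝ) ^ m) = m := log_unique le_rfl (zpow_lt' m)
  have hp : (2 : ℝ) ^ m ≠ 0 := by positivity
  have h4 : (-4 : ℝ) ^ m = (-1) ^ m * (2 ^ m) ^ 2 := by
    rw [← zpow_natCast, ← zpow_mul, mul_comm m, zpow_mul, ← mul_zpow]; norm_num
  unfold Gl
  rw [hl, h4]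
  rcases hm.lt_or_eq with h | h
  · simp only [Q, Q1, Q2, if_pos h]
    refine ⟨?_, ?_, ?_⟩ <;> field_simp <;> ring
  · subst h; norm_num [Q, Q1, Q2]

theorem Gl_crit {u : ℝ} (hu : 0 < u) (h : Gl Q1 u = 0) :
    u = p0 ∨ ∃ m : ℤ, m ≤ 0 ∧ u = 2 ^ m := by
  rcases lt_or_ge u 1 with h1 | h1
  · right
    have hl := (log_neg_iff hu).2 h1
    obtain ⟨a, b⟩ := log_spec hu
    unfold Gl at h
    generalize Int.log 2 u = m at *
    simp only [Q1, if_pos hl] at h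
    have hp : (0 : ℝ) < 2 ^ m := by positivity
    refine ⟨m, hl.le, ?_⟩
    have h' : (-1 : ℝ) ^ m ≠ 0 := zpow_ne_zero _ (by norm_num)
    have h2 := (mul_eq_zero.1 h).resolve_left h'
    rw [zpow_add_one₀ (by norm_num)] at b
    field_simp at h2
    have h3 : (u - 2 ^ m) * (u - 2 ^ m * 2) = 0 := by linear_combination h2 / 30
    rcases mul_eq_zero.1 h3 with h3 | h3 <;> linarith
  · rw [(Gl_ge h1).2.1] at h
    have h2 : (u - 1) * ((u - p0) * (u - 1 + (p0 - 1))) = 0 := by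
      linear_combination h / 225 - (u - 1) * p0_sq
    rcases mul_eq_zero.1 h2 with h3 | h3
    · right; exact ⟨0, le_rfl, by simp; linarith⟩
    · left
      have := p0_gt
      rcases mul_eq_zero.1 h3 with h3 | h3 <;> linarith

/-- decreasing diffeomorphism onto the positive half line -/
def sg (x : ℝ) : ℝ := √(1 + x ^ 2) - x
/-- derivative -/
def sg1 (x : ℝ) : ℝ := x / √(1 + x ^ 2) - 1

theorem sq_pos' (x : ℝ) : 0 < √(1 + x ^ 2) := Real.sqrt_pos.2 (by positivity)

theorem abs_lt_sq (x : ℝ) : |x| < √(1 + x ^ 2) := by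
  apply Real.lt_sqrt_of_sq_lt
  rw [sq_abs]; linarith

theorem sg_pos (x : ℝ) : 0 < sg x := by
  have := (abs_lt.1 (abs_lt_sq x)).2
  unfold sg; linarith

theorem sg1_neg (x : ℝ) : sg1 x < 0 := by
  have := (abs_lt.1 (abs_lt_sq x)).2
  have : x / √(1 + x ^ 2) < 1 := by rw [div_lt_one (sq_pos' x)]; exact this
  unfold sg1; linarith

theorem sg_eq (x : ℝ) : sg x * sg x + 2 * x * sg x = 1 := by
  have := Real.sq_sqrt (show (0 : ℝ) ≤ 1 + x ^ 2 by positivity)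
  unfold sg
  linear_combination this

theorem sg_unique {x u : ℝ} (hu : 0 < u) (h : u * u + 2 * x * u = 1) : u = sg x := by
  have h2 := sg_eq x
  have h3 : (u - sg x) * (u + sg x + 2 * x) = 0 := by linear_combination h - h2
  have := (abs_lt.1 (abs_lt_sq x)).1
  rcases mul_eq_zero.1 h3 with h | h
  · linarith
  · unfold sg at h; linarith

theorem sg_deriv (x : ℝ) : HasDerivAt sg (sg1 x) x := by
  have h := (((hasDerivAt_id x).pow 2).const_add 1).sqrt (by simp; positivity)
  refine (h.sub (hasDerivAt_id x)).congr_deriv ?_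
  have := sq_pos' x
  simp [sg1]; field_simp

theorem sg1_contDiff : ContDiff ℝ 1 sg1 := by
  unfold sg1
  refine ContDiff.sub (contDiff_id.div (ContDiff.sqrt (by fun_prop) ?_) ?_) contDiff_const
  · intro x; positivity
  · intro x; exact (sq_pos' x).ne'

theorem sg1_deriv (x : ℝ) : HasDerivAt sg1 (deriv sg1 x) x :=
  (sg1_contDiff.differentiable (by norm_num) x).hasDerivAt

theorem sg1_cont : Continuous (deriv sg1) := sg1_contDiff.continuous_deriv le_rfl

/-- inverse of `sg` -/
def ta (u : ℝ) : ℝ := (u⁻¹ - u) / 2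

theorem sg_ta {u : ℝ} (hu : 0 < u) : sg (ta u) = u := by
  refine (sg_unique hu ?_).symm
  unfold ta; field_simp; ring

theorem sg_inj {x y : ℝ} (h : sg x = sg y) : x = y := by
  have h1 := sg_eq x
  have h2 := sg_eq y
  have h3 := sg_pos y
  rw [h] at h1
  have : sg y * (x - y) = 0 := by linear_combination (h1 - h2) / 2
  rcases mul_eq_zero.1 this with h | h <;> linarith

/-- the Morse function -/
def ff (x : ℝ) : ℝ := Gl Q (sg x)
/-- first derivative -/
def ff1 (x : ℝ) : ℝ := Gl Q1 (sg x) * sg1 x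
/-- second derivative -/
def ff2 (x : ℝ) : ℝ := Gl Q2 (sg x) * sg1 x * sg1 x + Gl Q1 (sg x) * deriv sg1 x

theorem ff_deriv (x : ℝ) : HasDerivAt ff (ff1 x) x :=
  (Gl_deriv Q_match Q1_match Q_deriv (sg_pos x)).comp x (sg_deriv x)

theorem ff1_deriv (x : ℝ) : HasDerivAt ff1 (ff2 x) x :=
  ((Gl_deriv Q1_match Q2_match Q1_deriv (sg_pos x)).comp x (sg_deriv x)).mul (sg1_deriv x)

theorem ff2_cont : Continuous ff2 := by
  have hs : Continuous sg := continuous_iff_continuousAt.2 fun x => (sg_deriv x).continuousAt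
  have h1 : Continuous (fun x => Gl Q1 (sg x)) := continuous_iff_continuousAt.2 fun x =>
    ((Gl_deriv Q1_match Q2_match Q1_deriv (sg_pos x)).continuousAt).comp hs.continuousAt
  have h2 : Continuous (fun x => Gl Q2 (sg x)) := continuous_iff_continuousAt.2 fun x =>
    ContinuousAt.comp (Gl_cont Q2_match Q2_cont (sg_pos x)) hs.continuousAt
  have h3 : Continuous sg1 := sg1_contDiff.continuous
  have h4 := sg1_cont
  unfold ff2
  fun_prop

theorem ff_contDiff : ContDiff ℝ 2 ff := contDiff_two ff_deriv ff1_deriv ff2_cont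

theorem ff_crit {x : ℝ} (h : deriv ff x = 0) : Gl Q1 (sg x) = 0 := by
  rw [(ff_deriv x).deriv] at h
  exact (mul_eq_zero.1 h).resolve_right (sg1_neg x).ne

theorem ff_morse : IsMorseR ff := by
  constructor
  · intro x hx
    have h := ff_crit hx
    have e : deriv ff = ff1 := funext fun x => (ff_deriv x).deriv
    rw [e, (ff1_deriv x).deriv]
    unfold ff2
    rw [h, zero_mul, add_zero]
    refine mul_ne_zero (mul_ne_zero ?_ (sg1_neg x).ne) (sg1_neg x).ne
    rcases Gl_crit (sg_pos x) h with h | ⟨m, hm, h⟩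
    · rw [h, Gl_p0.2.2]; norm_num
    · rw [h, (Gl_pow m hm).2.2]
      exact mul_ne_zero (by norm_num) (zpow_ne_zero _ (by norm_num))
  · intro x y hx hy hxy hf
    apply hxy
    apply sg_inj
    unfold ff at hf
    have n4 : ∀ m : ℤ, (-4 : ℝ) ^ m ≠ 0 := fun m => zpow_ne_zero _ (by norm_num)
    rcases Gl_crit (sg_pos x) (ff_crit hx) with h | ⟨m, hm, h⟩ <;>
    rcases Gl_crit (sg_pos y) (ff_crit hy) with h' | ⟨n, hn, h'⟩
    · rw [h, h']
    · rw [h, h', Gl_p0.1, (Gl_pow n hn).1] at hf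
      exact absurd hf.symm (n4 n)
    · rw [h, h', Gl_p0.1, (Gl_pow m hm).1] at hf
      exact absurd hf (n4 m)
    · rw [h, h', (Gl_pow n hn).1, (Gl_pow m hm).1] at hf
      have := congrArg abs hf
      rw [abs_zpow, abs_zpow] at this
      have := zpow_right_injective₀ (by norm_num) (by norm_num) this
      rw [h, h', this]

theorem Gl_rel {u y : ℝ} (hu : 0 < u) : y = Gl Q u ↔
    ((1 ≤ u ∧ y = (1 + (-15 / 2) * ((u + -1) * (u + -1))) * (1 + (-15 / 2) * ((u + -1) * (u + -1))))
     ∨ (u < 1 ∧ ∃ v : ℝ, (∃ m : ℤ, v = 2 ^ m) ∧ ((v * v ≤ u ∧ u < 2 * (v * v) ∧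
        y * (v * v) = 10 * (u * (u * u)) + (-45) * (u * u) * (v * v) + 60 * u * ((v * v) * (v * v))
          + (-24) * ((v * v) * ((v * v) * (v * v)))) ∨
        (2 * (v * v) ≤ u ∧ u < 4 * (v * v) ∧
        (-1) * y * (2 * (v * v)) = 10 * (u * (u * u)) + (-45) * (u * u) * (2 * (v * v))
          + 60 * u * ((2 * (v * v)) * (2 * (v * v)))
          + (-24) * ((2 * (v * v)) * ((2 * (v * v)) * (2 * (v * v)))))))) := by
  rcases le_or_gt 1 u with h1 | h1
  · rw [(Gl_ge h1).1]
    simp only [h1, true_and, not_lt.2 h1, false_and, or_false]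
    constructor <;> intro h <;> rw [h] <;> ring
  · simp only [h1, true_and, not_le.2 h1, false_and, false_or]
    have hl := (log_neg_iff hu).2 h1
    have ev : ∀ k : ℤ, (2 : ℝ) ^ (k + k) = 2 ^ k * 2 ^ k := fun k => zpow_add₀ (by norm_num) _ _
    have od : ∀ k : ℤ, (2 : ℝ) ^ (2 * k + 1) = 2 * (2 ^ k * 2 ^ k) := fun k => by
      rw [zpow_add_one₀ (by norm_num), two_mul, ev]; ring
    have od2 : ∀ k : ℤ, (2 : ℝ) ^ (2 * k + 1 + 1) = 4 * (2 ^ k * 2 ^ k) := fun k => by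
      rw [zpow_add_one₀ (by norm_num), od]; ring
    have od1 : ∀ k : ℤ, (2 : ℝ) ^ (k + k + 1) = 2 * (2 ^ k * 2 ^ k) := fun k => by
      rw [← two_mul, od]
    have se : ∀ k : ℤ, (-1 : ℝ) ^ (k + k) = 1 := fun k => Even.neg_one_zpow ⟨k, rfl⟩
    have so : ∀ k : ℤ, (-1 : ℝ) ^ (2 * k + 1) = -1 := fun k => Odd.neg_one_zpow ⟨k, rfl⟩
    constructor
    · intro h
      obtain ⟨a, b⟩ := log_spec hu
      unfold Gl at h
      generalize Int.log 2 u = m at *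
      simp only [Q, if_pos hl] at h
      rcases Int.even_or_odd m with ⟨k, rfl⟩ | ⟨k, rfl⟩
      · have hp : (2 : ℝ) ^ k ≠ 0 := by positivity
        rw [ev] at a
        rw [od1] at b
        rw [ev, se] at h
        refine ⟨2 ^ k, ⟨k, rfl⟩, Or.inl ⟨a, b, ?_⟩⟩
        rw [h]; field_simp; ring
      · have hp : (2 : ℝ) ^ k ≠ 0 := by positivity
        rw [od] at a
        rw [od2] at b
        rw [od, so] at h
        refine ⟨2 ^ k, ⟨k, rfl⟩, Or.inr ⟨a, b, ?_⟩⟩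
        rw [h]; field_simp; ring
    · rintro ⟨v, ⟨k, rfl⟩, ⟨a, b, h⟩ | ⟨a, b, h⟩⟩
      · have hp : (2 : ℝ) ^ k ≠ 0 := by positivity
        have hm := log_unique (u := u) (m := k + k) (by rw [ev]; exact a) (by rw [od1]; exact b)
        unfold Gl
        rw [hm] at hl ⊢
        simp only [Q, if_pos hl]
        rw [ev, se]
        apply mul_right_cancel₀ (mul_ne_zero hp hp)
        rw [h]; field_simp; ring
      · have hp : (2 : ℝ) ^ k ≠ 0 := by positivity
        have hm := log_unique (u := u) (m := 2 * k + 1) (by rw [od]; exact a) (by rw [od2]; exact b)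
        unfold Gl
        rw [hm] at hl ⊢
        simp only [Q, if_pos hl]
        rw [od, so]
        have hp2 : (-1 : ℝ) * (2 * (2 ^ k * 2 ^ k)) ≠ 0 :=
          mul_ne_zero (by norm_num) (mul_ne_zero (by norm_num) (mul_ne_zero hp hp))
        apply mul_right_cancel₀ hp2
        rw [show y * (-1 * (2 * ((2 : ℝ) ^ k * 2 ^ k))) = -1 * y * (2 * (2 ^ k * 2 ^ k)) by ring, h]
        field_simp; ring

theorem ff_def (h : ExpandsOrderedField L)
    (hpow : IsDef L {x : Fin 1 → ℝ | ∃ m : ℤ, x 0 = 2 ^ m}) : IsDefFunR L ff := by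
  have key : ∀ x y : ℝ, y = ff x ↔ ∃ u : ℝ, 0 < u ∧ u * u + 2 * x * u = 1 ∧
    ((1 ≤ u ∧ y = (1 + (-15 / 2) * ((u + -1) * (u + -1))) * (1 + (-15 / 2) * ((u + -1) * (u + -1))))
     ∨ (u < 1 ∧ ∃ v : ℝ, (∃ m : ℤ, v = 2 ^ m) ∧ ((v * v ≤ u ∧ u < 2 * (v * v) ∧
        y * (v * v) = 10 * (u * (u * u)) + (-45) * (u * u) * (v * v) + 60 * u * ((v * v) * (v * v))
          + (-24) * ((v * v) * ((v * v) * (v * v)))) ∨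
        (2 * (v * v) ≤ u ∧ u < 4 * (v * v) ∧
        (-1) * y * (2 * (v * v)) = 10 * (u * (u * u)) + (-45) * (u * u) * (2 * (v * v))
          + 60 * u * ((2 * (v * v)) * (2 * (v * v)))
          + (-24) * ((2 * (v * v)) * ((2 * (v * v)) * (2 * (v * v)))))))) := by
    intro x y
    constructor
    · intro hy
      exact ⟨sg x, sg_pos x, sg_eq x, (Gl_rel (sg_pos x)).1 hy⟩
    · rintro ⟨u, hu, hx, hy⟩
      have := (Gl_rel hu).2 hy
      rw [sg_unique hu hx] at this
      exact this
  show DS L (fun z : Fin 2 → ℝ => z 1 = ff (z 0))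
  simp only [key]
  apply DS.ex
  refine (DS.lt h ?_ ?_).and ((DS.eq h ?_ ?_).and (((DS.le h ?_ ?_).and (DS.eq h ?_ ?_)).or
    ((DS.lt h ?_ ?_).and (DS.ex ((DS.pow hpow ?_).and
      (((DS.le h ?_ ?_).and ((DS.lt h ?_ ?_).and (DS.eq h ?_ ?_))).or
       ((DS.le h ?_ ?_).and ((DS.lt h ?_ ?_).and (DS.eq h ?_ ?_)))))))))
  all_goals
    repeat' first
      | exact DFn.const _
      | exact DFn.coord _
      | apply DFn.add h
      | apply DFn.mul h

theorem main (h : ExpandsOrderedField L)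
    (hpow : IsDef L {x : Fin 1 → ℝ | ∃ m : ℤ, x 0 = 2 ^ m}) :
    ∃ f : ℝ → ℝ, IsDefFunR L f ∧ ContDiff ℝ 2 f ∧ IsMorseR f ∧
      ∀ ε : ℝ → ℝ, IsDefFunR L ε → Continuous ε → (∀ x, 0 < ε x) →
        ∃ g : ℝ → ℝ, IsDefFunR L g ∧ ContDiff ℝ 2 g ∧
          (∀ j ≤ 2, ∀ x : ℝ, |iteratedDeriv j g x - iteratedDeriv j f x| < ε x) ∧
          ∃ x y : ℝ, x ≠ y ∧ deriv g x = 0 ∧ deriv g y = 0 ∧ g x = g y := by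
  refine ⟨ff, ff_def h hpow, ff_contDiff, ff_morse, ?_⟩
  intro ε _ hε hpos
  set p := ta p0 with hpdef
  have hp0 := p0_gt
  have hpn : p < 0 := by
    have : p0⁻¹ < 1 := inv_lt_one_of_one_lt₀ hp0
    rw [hpdef]; unfold ta; linarith
  obtain ⟨δ, hδ, hsm⟩ := small_exists (bump_contDiff p) (bump_supp p) hε hpos
  obtain ⟨n, hn⟩ := exists_pow_lt_of_lt_one hδ (show (1 / 4 : ℝ) < 1 by norm_num)
  set m : ℤ := -((n + 2 : ℕ) : ℤ) with hm
  set c : ℝ := (-4) ^ m with hc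
  have hcδ : |c| < δ := by
    have : |c| = (1 / 4) ^ (n + 2) := by
      rw [hc, hm, abs_zpow, zpow_neg, zpow_natCast, ← inv_pow]; norm_num
    rw [this]
    refine lt_of_le_of_lt ?_ hn
    exact pow_le_pow_of_le_one (by norm_num) (by norm_num) (by omega)
  set x := ta (2 ^ m) with hx
  have hx1 : 1 ≤ x := by
    have e : ((2 : ℝ) ^ m)⁻¹ = 2 ^ (n + 2) := by rw [hm, zpow_neg, inv_inv, zpow_natCast]
    have a : (4 : ℝ) ≤ 2 ^ (n + 2) := by
      have : (1 : ℝ) ≤ 2 ^ n := one_le_pow₀ (by norm_num)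
      rw [pow_add]; linarith
    have b : (2 : ℝ) ^ m ≤ 1 := zpow_le_one_of_nonpos₀ (by norm_num) (by omega)
    rw [hx]; unfold ta; rw [e]; linarith
  have hsx : sg x = 2 ^ m := sg_ta (by positivity)
  have hsp : sg p = p0 := sg_ta (by linarith)
  have hmx : mx (1 - (x - p) ^ 2) = 0 := mx_nonpos (by nlinarith)
  have hfx := Gl_pow m (by omega)
  have hd : ∀ y, HasDerivAt (fun x => ff x + c * bump p x) (ff1 y + c * bump1 p y) y := fun y =>
    (ff_deriv y).add ((bump_deriv p y).const_mul c)
  refine ⟨fun x => ff x + c * bump p x, ?_, ?_, ?_, p, x, by linarith, ?_, ?_, ?_⟩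
  · refine isDefFunR_add h (ff_def h hpow) ?_
    exact DS.eq h (DFn.coord 1) (DFn.mul h (DFn.const c) (DFn.comp (bump_def h p) (DFn.coord 0)))
  · exact ff_contDiff.add (contDiff_const.mul (bump_contDiff p))
  · intro j hj y
    have hj' : (j : WithTop ℕ∞) ≤ 2 := by exact_mod_cast hj
    have e : iteratedDeriv j (fun x => ff x + c * bump p x) y
        = iteratedDeriv j ff y + c * iteratedDeriv j (bump p) y := by
      rw [iteratedDeriv_fun_add (ff_contDiff.of_le hj').contDiffAt
        ((contDiff_const.mul (bump_contDiff p)).of_le hj').contDiffAt]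
      rw [iteratedDeriv_const_mul_field]
    rw [e, add_sub_cancel_left]
    exact hsm c hcδ j hj y
  · rw [(hd p).deriv]
    simp [ff1, hsp, Gl_p0.2.1, bump1]
  · rw [(hd x).deriv]
    simp [ff1, hsx, hfx.2.1, bump1, hmx]
  · simp only [ff, hsp, hsx, Gl_p0.1, hfx.1, bump, hmx]
    simp [mx, hc]

end Mine

/-- in the d-minimal structure `(ℝ, <, +, ·, 2^ℤ)` there is a definable `C²`
Morse function each of whose `D²`-neighborhoods contains a definable `C²` non-Morse
function; hence Morse functions are not open in `D²(ℝ)`. -/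
theorem stmt14 (L : FirstOrder.Language) [L.Structure ℝ]
    (hof : ExpandsOrderedField L) (hdmin : DMinimal L)
    (hpow : IsDef L {x : Fin 1 → ℝ | ∃ m : ℤ, x 0 = 2 ^ m}) :
    ∃ f : ℝ → ℝ, IsDefFunR L f ∧ ContDiff ℝ 2 f ∧ IsMorseR f ∧
      ∀ ε : ℝ → ℝ, IsDefFunR L ε → Continuous ε → (∀ x, 0 < ε x) →
        ∃ g : ℝ → ℝ, IsDefFunR L g ∧ ContDiff ℝ 2 g ∧
          (∀ j ≤ 2, ∀ x : ℝ, |iteratedDeriv j g x - iteratedDeriv j f x| < ε x) ∧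
          ∃ x y : ℝ, x ≠ y ∧ deriv g x = 0 ∧ deriv g y = 0 ∧ g x = g y := by
  exact main hof hpow

end DMinPaper
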